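/- Let x ∈ K^ℕ be semi-generic, along a subsequence (n_k), for a shift-invariant Borel probability measure μ, and let ξ be a joining of μ with a strictly ergodic shift-invariant measure ν. Then there exists a point y ∈ K^ℕ which is generic for ν and such that the pair (x,y) ∈ (K×K)^ℕ semi-generates ξ along a sub-subsequence of (n_k). -/

import Mathlib

open MeasureTheory Filter Topology

noncomputable section

/-- The shift map on complex-valued sequences. -/
def shift : (ℕ → ℂ) → (ℕ → ℂ) := fun x n => x (n + 1)

/-- The product shift on pairs of sequences. -/
def shift2 : (ℕ → ℂ) × (ℕ → ℂ) → (ℕ → ℂ) × (ℕ → ℂ) := fun p => (shift p.1, shift p.2)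

/-- Shift-invariant Borel probability measure. -/
def InvariantProb (μ : Measure (ℕ → ℂ)) : Prop :=
  IsProbabilityMeasure μ ∧ MeasurePreserving shift μ μ

/-- `μ` is a measure on `K^ℕ`: it gives full mass to sequences with values in `K`. -/
def SupportedOn (μ : Measure (ℕ → ℂ)) (K : Set ℂ) : Prop := μ {z | ∀ n, z n ∈ K} = 1

/-- A joining of `μ` and `ν`. -/
def IsJoining (ξ : Measure ((ℕ → ℂ) × (ℕ → ℂ))) (μ ν : Measure (ℕ → ℂ)) : Prop :=
  IsProbabilityMeasure ξ ∧ MeasurePreserving shift2 ξ ξ ∧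
    ξ.map Prod.fst = μ ∧ ξ.map Prod.snd = ν

/-- A point is generic for a shift-invariant measure. -/
def IsGeneric (x : ℕ → ℂ) (μ : Measure (ℕ → ℂ)) : Prop :=
  ∀ f : C((ℕ → ℂ), ℂ),
    Tendsto (fun n : ℕ => (n : ℂ)⁻¹ * ∑ i ∈ Finset.range n, f (shift^[i + 1] x))
      atTop (𝓝 (∫ z, f z ∂μ))

/-- The topological support of a measure. -/
def measSupport (μ : Measure (ℕ → ℂ)) : Set (ℕ → ℂ) :=
  {z | ∀ U : Set (ℕ → ℂ), IsOpen U → z ∈ U → 0 < μ U}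

/-- A strictly ergodic measure: a shift-invariant probability measure whose topological
support, viewed as a subshift, is minimal and uniquely ergodic. -/
def StrictlyErgodicMeasure (ν : Measure (ℕ → ℂ)) : Prop :=
  InvariantProb ν ∧
  (∀ z ∈ measSupport ν, closure (Set.range fun n => shift^[n] z) = measSupport ν) ∧
  (∃! ρ : Measure (ℕ → ℂ), InvariantProb ρ ∧ ρ (measSupport ν) = 1)

/-- `x` semi-generates `μ` along the subsequence `nk`: for every `m ≥ 1` and every block
`B` of length `m`, the frequency of occurrences of `B` in `x_{[1,n_k]}` converges to the
measure of the cylinder of `B`. -/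
def SemiGenerates (x : ℕ → ℂ) (nk : ℕ → ℕ) (μ : Measure (ℕ → ℂ)) : Prop :=
  ∀ m : ℕ, 0 < m → ∀ B : Fin m → ℂ,
    Tendsto (fun k : ℕ => (nk k : ℝ)⁻¹ *
        ((Finset.range (nk k)).filter fun i => ∀ j : Fin m, x (i + j.1) = B j).card)
      atTop (𝓝 ((μ {z | ∀ j : Fin m, z j.1 = B j}).toReal))

/-- A pair `(x,y)` semi-generates a measure `ξ` on the product symbolic space along the
subsequence `nk`. -/
def SemiGenerates2 (p : (ℕ → ℂ) × (ℕ → ℂ)) (nk : ℕ → ℕ)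
    (ξ : Measure ((ℕ → ℂ) × (ℕ → ℂ))) : Prop :=
  ∀ m : ℕ, 0 < m → ∀ B : Fin m → ℂ × ℂ,
    Tendsto (fun k : ℕ => (nk k : ℝ)⁻¹ *
        ((Finset.range (nk k)).filter
          fun i => ∀ j : Fin m, (p.1 (i + j.1), p.2 (i + j.1)) = B j).card)
      atTop (𝓝 ((ξ {q | ∀ j : Fin m, (q.1 j.1, q.2 j.1) = B j}).toReal))

/-- Splitting a sum over `range (a * b)` into `a` consecutive runs of length `b`. -/
lemma sum_range_mul_eq (f : ℕ → ℝ) (a b : ℕ) :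
    ∑ n ∈ Finset.range (a * b), f n =
      ∑ i ∈ Finset.range a, ∑ j ∈ Finset.range b, f (i * b + j) := by
  induction a with
  | zero => simp
  | succ a ih => rw [add_mul, one_mul, Finset.sum_range_add, ih, Finset.sum_range_succ]

/-- Greedy choice: if at every step, for every linear functional, some admissible choice of the
next increment does not increase that functional, then the increments can be chosen so that their
partial sums are `o(n)`. -/
lemma exists_greedy_choice {α ι : Type*} [Fintype ι] (G : ℕ → α → ι → ℝ) (ok : α → Prop) (D : ℝ)
    (hD : ∀ b c τ, ok c → |G b c τ| ≤ D)
    (h : ∀ (b : ℕ) (S : ι → ℝ), ∃ c, ok c ∧ ∑ τ, S τ * G b c τ ≤ 0) :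
    ∃ c : ℕ → α, (∀ b, ok (c b)) ∧ ∀ ε > 0, ∀ᶠ n : ℕ in atTop, ∀ τ,
      |∑ b ∈ Finset.range n, G b (c b) τ| ≤ ε * n := by
  choose pick hok hpick using h
  let S : ℕ → ι → ℝ := fun n => Nat.rec (motive := fun _ => ι → ℝ) (fun _ => 0)
    (fun b s τ => s τ + G b (pick b s) τ) n
  have hS : ∀ n τ, S n τ = ∑ b ∈ Finset.range n, G b (pick b (S b)) τ := by
    intro n τ
    induction n with
    | zero => simp [S]
    | succ n ih => rw [Finset.sum_range_succ, ← ih]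
  refine ⟨fun b => pick b (S b), fun b => hok _ _, ?_⟩
  have hsq : ∀ n, ∑ τ, S n τ ^ 2 ≤ n * (Fintype.card ι * D ^ 2) := by
    intro n
    induction n with
    | zero => simp [S]
    | succ n ih =>
      have hstep : ∑ τ, S (n + 1) τ ^ 2 = ∑ τ, S n τ ^ 2
          + 2 * ∑ τ, S n τ * G n (pick n (S n)) τ + ∑ τ, G n (pick n (S n)) τ ^ 2 := by
        rw [Finset.mul_sum, ← Finset.sum_add_distrib, ← Finset.sum_add_distrib]
        refine Finset.sum_congr rfl fun τ _ => ?_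
        change (S n τ + G n (pick n (S n)) τ) ^ 2 = _
        ring
      have hbd : ∑ τ, G n (pick n (S n)) τ ^ 2 ≤ Fintype.card ι * D ^ 2 := by
        refine (Finset.sum_le_card_nsmul _ _ (D ^ 2) fun τ _ => ?_).trans (by simp)
        exact sq_le_sq' (abs_le.1 (hD _ _ τ (hok _ _))).1 (abs_le.1 (hD _ _ τ (hok _ _))).2
      have := hpick n (S n)
      push_cast
      linarith
  intro ε hε
  obtain ⟨N, hN⟩ := exists_nat_ge (Fintype.card ι * D ^ 2 / ε ^ 2)
  filter_upwards [eventually_ge_atTop N] with n hn τ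
  rw [← hS]
  refine abs_le_of_sq_le_sq ?_ (by positivity)
  have h1 : S n τ ^ 2 ≤ ∑ τ, S n τ ^ 2 :=
    Finset.single_le_sum (f := fun τ => S n τ ^ 2) (fun _ _ => sq_nonneg _) (Finset.mem_univ τ)
  have h2 : Fintype.card ι * D ^ 2 ≤ n * ε ^ 2 := by
    rw [div_le_iff₀ (by positivity)] at hN
    have : (N : ℝ) ≤ n := by exact_mod_cast hn
    nlinarith [sq_nonneg ε]
  have h3 := hsq n
  nlinarith [(Nat.cast_nonneg n : (0 : ℝ) ≤ n)]

/-- Comparison of a sum over a window of length `L * (T + 1)` with the sum over `T` consecutive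
runs of length `L` starting at offset `r`, each truncated by `M`. -/
lemma window_sum_bounds (g : ℕ → ℝ) (h0 : ∀ n, 0 ≤ g n) (h1 : ∀ n, g n ≤ 1) {L T M r : ℕ}
    (hr : r ≤ L) (hM : M ≤ L) :
    ∑ j ∈ Finset.range T, ∑ i ∈ Finset.range (L - M), g (r + j * L + i) ≤
        ∑ o ∈ Finset.range (L * (T + 1)), g o ∧
      ∑ o ∈ Finset.range (L * (T + 1)), g o ≤
        ∑ j ∈ Finset.range T, ∑ i ∈ Finset.range (L - M), g (r + j * L + i) + (L + T * M) := by
  have hsum : ∀ a : ℕ, ∀ f : ℕ → ℝ, (∀ n, 0 ≤ f n) → (∀ n, f n ≤ 1) →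
      0 ≤ ∑ i ∈ Finset.range a, f i ∧ ∑ i ∈ Finset.range a, f i ≤ a := fun a f hf0 hf1 =>
    ⟨Finset.sum_nonneg fun i _ => hf0 i,
      (Finset.sum_le_card_nsmul _ _ 1 fun i _ => hf1 i).trans (by simp)⟩
  have hlen : L * (T + 1) = r + (T * L + (L - r)) := by
    have : L * (T + 1) = T * L + L := by ring
    omega
  have hrow : ∀ j, ∑ i ∈ Finset.range (L - M), g (r + j * L + i) ≤
        ∑ i ∈ Finset.range L, g (r + j * L + i) ∧ ∑ i ∈ Finset.range L, g (r + j * L + i) ≤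
        ∑ i ∈ Finset.range (L - M), g (r + j * L + i) + M := by
    intro j
    have e : L = (L - M) + M := by omega
    have e2 := Finset.sum_range_add (fun i => g (r + j * L + i)) (L - M) M
    rw [← e] at e2
    have := hsum M (fun i => g (r + j * L + (L - M + i))) (fun _ => h0 _) (fun _ => h1 _)
    constructor <;> linarith
  have hmid : ∑ o ∈ Finset.range (T * L), g (r + o) =
      ∑ j ∈ Finset.range T, ∑ i ∈ Finset.range L, g (r + j * L + i) := by
    rw [sum_range_mul_eq (fun o => g (r + o))]
    simp only [add_assoc]
  have hlo := Finset.sum_le_sum fun j (_ : j ∈ Finset.range T) => (hrow j).1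
  have hhi := Finset.sum_le_sum fun j (_ : j ∈ Finset.range T) => (hrow j).2
  rw [Finset.sum_add_distrib, Finset.sum_const, Finset.card_range, nsmul_eq_mul] at hhi
  rw [hlen, Finset.sum_range_add, Finset.sum_range_add, hmid]
  have a1 := hsum r g h0 h1
  have a2 := hsum (L - r) (fun i => g (r + (T * L + i))) (fun _ => h0 _) (fun _ => h1 _)
  rw [Nat.cast_sub hr] at a2
  constructor <;> linarith

/-- The indicator of an occurrence of the pair block `τ` in `(u, z)` at position `i`. -/
def blockHit (τ : Σ m : ℕ, Fin m → ℂ × ℂ) (u z : ℕ → ℂ) (i : ℕ) : ℝ :=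
  Set.indicator {n | ∀ j : Fin τ.1, (u (n + j), z (n + j)) = τ.2 j} 1 i

/-- The set of pairs of sequences starting with the block `τ`. -/
def pairCylinder (τ : Σ m : ℕ, Fin m → ℂ × ℂ) : Set ((ℕ → ℂ) × (ℕ → ℂ)) :=
  {q | ∀ j : Fin τ.1, (q.1 j, q.2 j) = τ.2 j}

/-- The set of pairs of sequences whose first entry starts with the block `B`. -/
def fstCylinder {L : ℕ} (B : Fin L → ℂ) : Set ((ℕ → ℂ) × (ℕ → ℂ)) :=
  {q | ∀ j : Fin L, q.1 j = B j}

lemma blockHit_nonneg (τ : Σ m : ℕ, Fin m → ℂ × ℂ) (u z : ℕ → ℂ) (i : ℕ) :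
    0 ≤ blockHit τ u z i :=
  Set.indicator_nonneg (fun _ _ => zero_le_one) i

lemma blockHit_le_one (τ : Σ m : ℕ, Fin m → ℂ × ℂ) (u z : ℕ → ℂ) (i : ℕ) :
    blockHit τ u z i ≤ 1 :=
  Set.indicator_le_self' (fun _ _ => zero_le_one) i

lemma blockHit_congr {τ : Σ m : ℕ, Fin m → ℂ × ℂ} {u z u' z' : ℕ → ℂ} {i i' : ℕ}
    (hu : ∀ j < τ.1, u (i + j) = u' (i' + j)) (hz : ∀ j < τ.1, z (i + j) = z' (i' + j)) :
    blockHit τ u z i = blockHit τ u' z' i' := by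
  have : i ∈ {n | ∀ j : Fin τ.1, (u (n + j), z (n + j)) = τ.2 j} ↔
      i' ∈ {n | ∀ j : Fin τ.1, (u' (n + j), z' (n + j)) = τ.2 j} :=
    forall_congr' fun j => by rw [hu j j.2, hz j j.2]
  unfold blockHit
  by_cases h : i ∈ {n | ∀ j : Fin τ.1, (u (n + j), z (n + j)) = τ.2 j}
  · rw [Set.indicator_of_mem h, Set.indicator_of_mem (this.1 h)]; rfl
  · rw [Set.indicator_of_notMem h, Set.indicator_of_notMem (fun h' => h (this.2 h'))]

lemma shift_iterate_apply (i : ℕ) (z : ℕ → ℂ) (n : ℕ) : (shift^[i] z) n = z (n + i) := by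
  induction i generalizing z with
  | zero => rfl
  | succ i ih => rw [Function.iterate_succ_apply, ih]; simp [shift, add_assoc]

lemma shift2_iterate (i : ℕ) (q : (ℕ → ℂ) × (ℕ → ℂ)) :
    shift2^[i] q = (shift^[i] q.1, shift^[i] q.2) := by
  induction i generalizing q with
  | zero => rfl
  | succ i ih => rw [Function.iterate_succ_apply, ih]; rfl

lemma measurableSet_pairCylinder (τ : Σ m : ℕ, Fin m → ℂ × ℂ) :
    MeasurableSet (pairCylinder τ) := by
  have : pairCylinder τ = ⋂ j : Fin τ.1,
      (fun q : (ℕ → ℂ) × (ℕ → ℂ) => (q.1 j, q.2 j)) ⁻¹' {τ.2 j} := by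
    ext q; simp [pairCylinder]
  rw [this]
  exact MeasurableSet.iInter fun j => (by fun_prop : Measurable _) (measurableSet_singleton _)

lemma measurableSet_fstCylinder {L : ℕ} (B : Fin L → ℂ) : MeasurableSet (fstCylinder B) := by
  have : fstCylinder B = ⋂ j : Fin L,
      (fun q : (ℕ → ℂ) × (ℕ → ℂ) => q.1 j) ⁻¹' {B j} := by
    ext q; simp [fstCylinder]
  rw [this]
  exact MeasurableSet.iInter fun j => (by fun_prop : Measurable _) (measurableSet_singleton _)

lemma blockHit_eq_indicator (τ : Σ m : ℕ, Fin m → ℂ × ℂ) (q : (ℕ → ℂ) × (ℕ → ℂ)) (i : ℕ) :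
    blockHit τ q.1 q.2 i = (pairCylinder τ).indicator 1 (shift2^[i] q) := by
  rw [shift2_iterate]
  have : i ∈ {n | ∀ j : Fin τ.1, (q.1 (n + j), q.2 (n + j)) = τ.2 j} ↔
      (shift^[i] q.1, shift^[i] q.2) ∈ pairCylinder τ :=
    forall_congr' fun j => by simp [shift_iterate_apply, add_comm]
  unfold blockHit
  by_cases h : i ∈ {n | ∀ j : Fin τ.1, (q.1 (n + j), q.2 (n + j)) = τ.2 j}
  · rw [Set.indicator_of_mem h, Set.indicator_of_mem (this.1 h)]; rfl
  · rw [Set.indicator_of_notMem h, Set.indicator_of_notMem (fun h' => h (this.2 h'))]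

lemma measurable_shift : Measurable shift :=
  measurable_pi_lambda _ fun n => measurable_pi_apply (n + 1)

lemma measurable_shift2 : Measurable shift2 :=
  (measurable_shift.comp measurable_fst).prodMk (measurable_shift.comp measurable_snd)

lemma measurable_blockHit (τ : Σ m : ℕ, Fin m → ℂ × ℂ) (i : ℕ) :
    Measurable fun q : (ℕ → ℂ) × (ℕ → ℂ) => blockHit τ q.1 q.2 i := by
  simp only [blockHit_eq_indicator]
  exact (measurable_one.indicator (measurableSet_pairCylinder τ)).comp
    (measurable_shift2.iterate i)

lemma integrable_blockHit (τ : Σ m : ℕ, Fin m → ℂ × ℂ) (i : ℕ)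
    (ξ : Measure ((ℕ → ℂ) × (ℕ → ℂ))) [IsFiniteMeasure ξ] :
    Integrable (fun q : (ℕ → ℂ) × (ℕ → ℂ) => blockHit τ q.1 q.2 i) ξ :=
  Integrable.of_bound (measurable_blockHit τ i).aestronglyMeasurable 1 <| ae_of_all _ fun q => by
    rw [Real.norm_of_nonneg (blockHit_nonneg _ _ _ _)]
    exact blockHit_le_one _ _ _ _

lemma integral_blockHit (τ : Σ m : ℕ, Fin m → ℂ × ℂ) (i : ℕ)
    {ξ : Measure ((ℕ → ℂ) × (ℕ → ℂ))} (hξ : MeasurePreserving shift2 ξ ξ) :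
    ∫ q, blockHit τ q.1 q.2 i ∂ξ = ξ.real (pairCylinder τ) := by
  simp only [blockHit_eq_indicator]
  have hi := hξ.iterate i
  have hm : Measurable ((pairCylinder τ).indicator (1 : (ℕ → ℂ) × (ℕ → ℂ) → ℝ)) :=
    measurable_one.indicator (measurableSet_pairCylinder τ)
  rw [← integral_map hi.measurable.aemeasurable hm.aestronglyMeasurable, hi.map_eq,
    integral_indicator_one (measurableSet_pairCylinder τ)]

/-- The number of occurrences of the pair block `τ` in `(u, z)` starting before `n`. -/
def hitCount (n : ℕ) (u z : ℕ → ℂ) (τ : Σ m : ℕ, Fin m → ℂ × ℂ) : ℝ :=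
  ∑ i ∈ Finset.range n, blockHit τ u z i

lemma hitCount_nonneg (n : ℕ) (u z : ℕ → ℂ) (τ : Σ m : ℕ, Fin m → ℂ × ℂ) :
    0 ≤ hitCount n u z τ :=
  Finset.sum_nonneg fun _ _ => blockHit_nonneg _ _ _ _

lemma hitCount_le (n : ℕ) (u z : ℕ → ℂ) (τ : Σ m : ℕ, Fin m → ℂ × ℂ) :
    hitCount n u z τ ≤ n :=
  (Finset.sum_le_card_nsmul _ _ 1 fun _ _ => blockHit_le_one _ _ _ _).trans (by simp)

lemma integrable_hitCount (n : ℕ) (τ : Σ m : ℕ, Fin m → ℂ × ℂ)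
    (ξ : Measure ((ℕ → ℂ) × (ℕ → ℂ))) [IsFiniteMeasure ξ] :
    Integrable (fun q : (ℕ → ℂ) × (ℕ → ℂ) => hitCount n q.1 q.2 τ) ξ :=
  integrable_finsetSum _ fun i _ => integrable_blockHit τ i ξ

lemma integral_hitCount (n : ℕ) (τ : Σ m : ℕ, Fin m → ℂ × ℂ)
    {ξ : Measure ((ℕ → ℂ) × (ℕ → ℂ))} [IsFiniteMeasure ξ] (hξ : MeasurePreserving shift2 ξ ξ) :
    ∫ q, hitCount n q.1 q.2 τ ∂ξ = n * ξ.real (pairCylinder τ) := by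
  unfold hitCount
  rw [integral_finsetSum _ fun i _ => integrable_blockHit τ i ξ]
  simp [integral_blockHit τ _ hξ]

/-- Conditional expectations of the hit counts given the block `B` of the first coordinate,
together with the fact that the second coordinate can always be chosen so as not to exceed the
expectation of a prescribed linear functional. -/
lemma exists_conditional_hitCount {ι : Type*} [Fintype ι] (β : ι → Σ m : ℕ, Fin m → ℂ × ℂ)
    {L N : ℕ} (hβ : ∀ τ, N + (β τ).1 ≤ L)
    (ξ : Measure ((ℕ → ℂ) × (ℕ → ℂ))) [IsProbabilityMeasure ξ] {Y : Set (ℕ → ℂ)}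
    (hY : ∀ᵐ q ∂ξ, q.2 ∈ Y) :
    ∃ F : (Fin L → ℂ) → ι → ℝ, (∀ B τ, 0 ≤ F B τ ∧ F B τ ≤ N) ∧
      (∀ (u : ℕ → ℂ) (S : ι → ℝ), ∃ z ∈ Y,
        ∑ τ, S τ * (hitCount N u z (β τ) - F (fun j => u j) τ) ≤ 0) ∧
      ∀ B τ, ξ.real (fstCylinder B) * F B τ =
        ∫ q in fstCylinder B, hitCount N q.1 q.2 (β τ) ∂ξ := by
  have hlocal : ∀ (B : Fin L → ℂ) (u u' z : ℕ → ℂ) (τ : ι), (∀ j : Fin L, u j = B j) →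
      (∀ j : Fin L, u' j = B j) → hitCount N u z (β τ) = hitCount N u' z (β τ) := by
    intro B u u' z τ hu hu'
    refine Finset.sum_congr rfl fun i hi => blockHit_congr (fun j hj => ?_) fun _ _ => rfl
    have hlt : i + j < L := by have := hβ τ; have := Finset.mem_range.1 hi; omega
    rw [hu ⟨i + j, hlt⟩, hu' ⟨i + j, hlt⟩]
  have key : ∀ B : Fin L → ℂ, ∃ v : ι → ℝ, (∀ τ, 0 ≤ v τ ∧ v τ ≤ N) ∧
      (∀ (u : ℕ → ℂ) (S : ι → ℝ), (∀ j : Fin L, u j = B j) → ∃ z ∈ Y,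
        ∑ τ, S τ * (hitCount N u z (β τ) - v τ) ≤ 0) ∧
      ∀ τ, ξ.real (fstCylinder B) * v τ =
        ∫ q in fstCylinder B, hitCount N q.1 q.2 (β τ) ∂ξ := by
    intro B
    by_cases hB : ξ (fstCylinder B) = 0
    · obtain ⟨q, hq⟩ := hY.exists
      let u₀ : ℕ → ℂ := fun i => if h : i < L then B ⟨i, h⟩ else 0
      refine ⟨fun τ => hitCount N u₀ q.2 (β τ),
        fun τ => ⟨hitCount_nonneg _ _ _ _, hitCount_le _ _ _ _⟩, fun u S hu => ⟨q.2, hq, ?_⟩,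
        fun τ => ?_⟩
      · refine (Finset.sum_eq_zero fun τ _ => ?_).le
        rw [hlocal B u u₀ q.2 τ hu (fun j => by simp [u₀]), sub_self, mul_zero]
      · rw [Measure.real, hB, Measure.restrict_eq_zero.2 hB]
        simp
    · have hreal : 0 < ξ.real (fstCylinder B) := lt_of_le_of_ne' measureReal_nonneg
        ((measureReal_ne_zero_iff (measure_ne_top _ _)).2 hB)
      have hmul : ∀ τ, ξ.real (fstCylinder B) *
          (⨍ q in fstCylinder B, hitCount N q.1 q.2 (β τ) ∂ξ) =
          ∫ q in fstCylinder B, hitCount N q.1 q.2 (β τ) ∂ξ := by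
        intro τ
        rw [setAverage_eq, smul_eq_mul, mul_inv_cancel_left₀ hreal.ne']
      refine ⟨fun τ => ⨍ q in fstCylinder B, hitCount N q.1 q.2 (β τ) ∂ξ, fun τ => ?_,
        fun u S hu => ?_, hmul⟩
      · have h0 : 0 ≤ ∫ q in fstCylinder B, hitCount N q.1 q.2 (β τ) ∂ξ :=
          integral_nonneg fun q => hitCount_nonneg _ _ _ _
        have h1 : ∫ q in fstCylinder B, hitCount N q.1 q.2 (β τ) ∂ξ ≤
            ξ.real (fstCylinder B) * N := by
          refine (integral_mono (integrable_hitCount _ _ _) (integrable_const (N : ℝ))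
            fun q => hitCount_le _ _ _ _).trans ?_
          simp
        rw [← hmul τ] at h0 h1
        exact ⟨nonneg_of_mul_nonneg_right h0 hreal, le_of_mul_le_mul_left h1 hreal⟩
      · let f : (ℕ → ℂ) × (ℕ → ℂ) → ℝ := fun q => ∑ τ, S τ * hitCount N q.1 q.2 (β τ)
        have hf : Integrable f ξ :=
          integrable_finsetSum _ fun τ _ => (integrable_hitCount N (β τ) ξ).const_mul _
        have hYr : ∀ᵐ q ∂(ξ.restrict (fstCylinder B)), q.2 ∈ Y ∧ q ∈ fstCylinder B :=
          (ae_restrict_of_ae hY).and (ae_restrict_mem (measurableSet_fstCylinder B))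
        have hne : ξ.restrict (fstCylinder B) ≠ 0 := by simpa using hB
        obtain ⟨q, hqn, hq⟩ := exists_notMem_null_le_average hne hf.restrict (ae_iff.1 hYr)
        have hqY : q.2 ∈ Y ∧ q ∈ fstCylinder B := by simpa using hqn
        refine ⟨q.2, hqY.1, ?_⟩
        have hav : ⨍ q in fstCylinder B, f q ∂ξ =
            ∑ τ, S τ * ⨍ q in fstCylinder B, hitCount N q.1 q.2 (β τ) ∂ξ := by
          simp only [setAverage_eq, smul_eq_mul, f]
          rw [integral_finsetSum _ fun τ _ =>
              ((integrable_hitCount N (β τ) ξ).const_mul _).restrict,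
            Finset.mul_sum]
          refine Finset.sum_congr rfl fun τ _ => ?_
          rw [integral_const_mul]
          ring
        rw [hav] at hq
        simp only [mul_sub, Finset.sum_sub_distrib]
        have : ∑ τ, S τ * hitCount N u q.2 (β τ) = f q :=
          Finset.sum_congr rfl fun τ _ => by rw [hlocal B u q.1 q.2 τ hu hqY.2]
        linarith
  choose F hF1 hF2 hF3 using key
  exact ⟨F, hF1, fun u S => hF2 _ u S fun _ => rfl, hF3⟩

/-- Along a subsequence that semi-generates `μ`, averages of a function of the first `L` letters
converge to its integral. -/
lemma tendsto_average_of_semiGenerates {K : Set ℂ} (hKfin : K.Finite) {x : ℕ → ℂ}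
    (hx : ∀ n, x n ∈ K) {nk : ℕ → ℕ} {μ : Measure (ℕ → ℂ)} (hsemi : SemiGenerates x nk μ)
    {L : ℕ} (hL : 0 < L) (f : (Fin L → ℂ) → ℝ) :
    Tendsto (fun k => (nk k : ℝ)⁻¹ * ∑ n ∈ Finset.range (nk k), f fun j => x (n + j)) atTop
      (𝓝 (∑ B ∈ Fintype.piFinset fun _ : Fin L => hKfin.toFinset,
        μ.real {z | ∀ j : Fin L, z j = B j} * f B)) := by
  classical
  have hlim := tendsto_finsetSum (Fintype.piFinset fun _ : Fin L => hKfin.toFinset)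
    fun B _ => (hsemi L hL B).mul_const (f B)
  refine hlim.congr fun k => ?_
  simp only [mul_assoc]
  rw [← Finset.mul_sum]
  congr 1
  rw [← Finset.sum_fiberwise_of_maps_to (s := Finset.range (nk k))
    (t := Fintype.piFinset fun _ : Fin L => hKfin.toFinset) (g := fun n j => x (n + j))
    (by intro n _; simp [hx])]
  refine Finset.sum_congr rfl fun B _ => ?_
  rw [Finset.sum_congr rfl (g := fun _ => f B)
    (fun n hn => by rw [(Finset.mem_filter.1 hn).2]), Finset.sum_const, nsmul_eq_mul]
  congr 2
  simp only [funext_iff]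

lemma sum_setIntegral_fstCylinder {K : Set ℂ} (hKfin : K.Finite)
    {ξ : Measure ((ℕ → ℂ) × (ℕ → ℂ))} (hK : ∀ᵐ q ∂ξ, ∀ n, q.1 n ∈ K) (L : ℕ)
    {f : (ℕ → ℂ) × (ℕ → ℂ) → ℝ} (hf : Integrable f ξ) :
    ∑ B ∈ Fintype.piFinset fun _ : Fin L => hKfin.toFinset, ∫ q in fstCylinder B, f q ∂ξ =
      ∫ q, f q ∂ξ := by
  rw [← integral_biUnion_finset _ (fun B _ => measurableSet_fstCylinder B) ?_
    (fun B _ => hf.integrableOn)]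
  · refine setIntegral_eq_integral_of_ae_compl_eq_zero ?_
    filter_upwards [hK] with q hq hq'
    refine absurd (Set.mem_biUnion (x := fun j : Fin L => q.1 j) ?_ ?_) hq'
    · simp [hq]
    · exact fun j => rfl
  · intro B _ B' _ hne
    refine Set.disjoint_left.2 fun q hq hq' => hne (funext fun j => ?_)
    rw [← hq j, hq' j]

lemma measureReal_fstCylinder {ξ : Measure ((ℕ → ℂ) × (ℕ → ℂ))} {L : ℕ} (B : Fin L → ℂ) :
    (ξ.map Prod.fst).real {z | ∀ j : Fin L, z j = B j} = ξ.real (fstCylinder B) := by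
  have : {z : ℕ → ℂ | ∀ j : Fin L, z j = B j} = ⋂ j : Fin L, (fun z => z j) ⁻¹' {B j} := by
    ext; simp
  rw [map_measureReal_apply measurable_fst]
  · rfl
  · rw [this]
    exact MeasurableSet.iInter fun j => measurable_pi_apply _ (measurableSet_singleton _)

/-- The starting position of the `b`-th block when windows of length `L * (T + 1)` each contain `T`
consecutive blocks of length `L`, placed at offset `r w` in the `w`-th window. -/
def blockPos (L T : ℕ) (r : ℕ → ℕ) (b : ℕ) : ℕ :=
  b / T * (L * (T + 1)) + (r (b / T) + b % T * L)

lemma blockPos_mul_add {L T : ℕ} (r : ℕ → ℕ) (w : ℕ) {j : ℕ} (hj : j < T) :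
    blockPos L T r (w * T + j) = w * (L * (T + 1)) + (r w + j * L) := by
  have h1 : (w * T + j) / T = w := by
    rw [mul_comm, Nat.mul_add_div (by omega), Nat.div_eq_of_lt hj, add_zero]
  have h2 : (w * T + j) % T = j := by
    rw [mul_comm, Nat.mul_add_mod, Nat.mod_eq_of_lt hj]
  rw [blockPos, h1, h2]

lemma blockPos_injective {L T : ℕ} (hT : 0 < T) {r : ℕ → ℕ} (hr : ∀ w, r w < L) :
    Function.Injective fun p : ℕ × Fin L => blockPos L T r p.1 + p.2 := by
  rintro ⟨b, i⟩ ⟨b', i'⟩ h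
  have hL : 0 < L := (Nat.zero_le _).trans_lt (hr 0)
  have hin : ∀ (b : ℕ) (i : Fin L), r (b / T) + b % T * L + i < L * (T + 1) := by
    intro b i
    have h1 := hr (b / T)
    have h2 : (b % T + 1) * L ≤ T * L := Nat.mul_le_mul_right _ (Nat.mod_lt b hT)
    have h3 := i.2
    have h4 : L * (T + 1) = T * L + L := by ring
    rw [add_mul] at h2
    omega
  have hdiv : ∀ (b : ℕ) (i : Fin L), (blockPos L T r b + i) / (L * (T + 1)) = b / T := by
    intro b i
    rw [blockPos, add_assoc, mul_comm (b / T), Nat.mul_add_div (by positivity),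
      Nat.div_eq_of_lt (hin b i), add_zero]
  have hb : b / T = b' / T := by rw [← hdiv b i, ← hdiv b' i']; exact congrArg (· / _) h
  have h5 : b % T * L + i = b' % T * L + i' := by
    simp only [blockPos, hb] at h
    omega
  have hdivL : ∀ (a : ℕ) (i : Fin L), (a * L + i) / L = a := by
    intro a i
    rw [mul_comm, Nat.mul_add_div hL, Nat.div_eq_of_lt i.2, add_zero]
  have hm : b % T = b' % T := by rw [← hdivL (b % T) i, h5, hdivL]
  have hbb : b = b' := by rw [← Nat.div_add_mod b T, hb, hm, Nat.div_add_mod]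
  rw [hm] at h5
  exact Prod.ext hbb (Fin.ext (by simpa using h5))

lemma sum_blockPos_bounds (g : ℕ → ℝ) (h0 : ∀ n, 0 ≤ g n) (h1 : ∀ n, g n ≤ 1) {L T M : ℕ}
    {r : ℕ → ℕ} (hr : ∀ w, r w < L) (hM : M ≤ L) (J : ℕ) :
    ∑ b ∈ Finset.range (J * T), ∑ i ∈ Finset.range (L - M), g (blockPos L T r b + i) ≤
        ∑ n ∈ Finset.range (J * (L * (T + 1))), g n ∧
      ∑ n ∈ Finset.range (J * (L * (T + 1))), g n ≤
        ∑ b ∈ Finset.range (J * T), ∑ i ∈ Finset.range (L - M), g (blockPos L T r b + i) +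
          J * (L + T * M) := by
  have hw : ∀ w, _ := fun w => window_sum_bounds (fun n => g (w * (L * (T + 1)) + n))
    (fun _ => h0 _) (fun _ => h1 _) (T := T) (hr w).le hM
  rw [sum_range_mul_eq, sum_range_mul_eq]
  have hpos : ∀ w, ∑ j ∈ Finset.range T, ∑ i ∈ Finset.range (L - M),
      g (blockPos L T r (w * T + j) + i) = ∑ j ∈ Finset.range T, ∑ i ∈ Finset.range (L - M),
      g (w * (L * (T + 1)) + (r w + j * L + i)) := fun w =>
    Finset.sum_congr rfl fun j hj => by
      rw [blockPos_mul_add r w (Finset.mem_range.1 hj)]; simp only [add_assoc]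
  simp only [hpos]
  refine ⟨Finset.sum_le_sum fun w _ => (hw w).1, ?_⟩
  refine (Finset.sum_le_sum fun w _ => (hw w).2).trans ?_
  rw [Finset.sum_add_distrib]
  simp [mul_add]

lemma sum_range_div_mul_bounds (g : ℕ → ℝ) {D : ℝ} (h0 : ∀ n, 0 ≤ g n) (h1 : ∀ n, g n ≤ D)
    {W : ℕ} (hW : 0 < W) (n : ℕ) :
    ∑ i ∈ Finset.range (n / W * W), g i ≤ ∑ i ∈ Finset.range n, g i ∧
      ∑ i ∈ Finset.range n, g i ≤ ∑ i ∈ Finset.range (n / W * W), g i + W * D := by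
  have hn := Nat.div_add_mod' n W
  have hs := Finset.sum_range_add g (n / W * W) (n % W)
  rw [hn] at hs
  have hlt : ((n % W : ℕ) : ℝ) ≤ W := by exact_mod_cast (Nat.mod_lt n hW).le
  have h2 : ∑ i ∈ Finset.range (n % W), g (n / W * W + i) ≤ (n % W : ℕ) * D :=
    (Finset.sum_le_card_nsmul _ _ D fun _ _ => h1 _).trans (by simp)
  have h3 : 0 ≤ ∑ i ∈ Finset.range (n % W), g (n / W * W + i) :=
    Finset.sum_nonneg fun _ _ => h0 _
  have h4 := mul_le_mul_of_nonneg_right hlt ((h0 0).trans (h1 0))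
  constructor <;> linarith

/-- Averaging the block sums of a window over all offsets recovers, up to one block length, the
average over the window. -/
lemma sum_offset_average_bounds (f : ℕ → ℝ) {L : ℕ} (T : ℕ) (hL : 0 < L) (h0 : ∀ n, 0 ≤ f n)
    (h1 : ∀ n, f n ≤ L) (J : ℕ) :
    |∑ w ∈ Finset.range J, (L : ℝ)⁻¹ * ∑ r ∈ Finset.range L, ∑ j ∈ Finset.range T,
        f (w * (L * (T + 1)) + (r + j * L)) -
      (L : ℝ)⁻¹ * ∑ n ∈ Finset.range (J * (L * (T + 1))), f n| ≤ J * L := by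
  rw [sum_range_mul_eq, Finset.mul_sum, ← Finset.sum_sub_distrib]
  refine (Finset.abs_sum_le_sum_abs _ _).trans
    ((Finset.sum_le_card_nsmul _ _ (L : ℝ) fun w _ => ?_).trans (by simp))
  have hL' : (0 : ℝ) < L := by exact_mod_cast hL
  have hlen : L * (T + 1) = T * L + L := by ring
  have hsum : ∑ r ∈ Finset.range L, ∑ j ∈ Finset.range T,
      f (w * (L * (T + 1)) + (r + j * L)) =
      ∑ o ∈ Finset.range (T * L), f (w * (L * (T + 1)) + o) := by
    rw [Finset.sum_comm, sum_range_mul_eq (fun o => f (w * (L * (T + 1)) + o))]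
    simp only [add_comm]
  have hsplit := Finset.sum_range_add (fun o => f (w * (L * (T + 1)) + o)) (T * L) L
  rw [← hlen] at hsplit
  rw [hsum, hsplit, ← mul_sub, sub_add_cancel_left, abs_mul, abs_neg, abs_of_pos (inv_pos.2 hL'),
    abs_of_nonneg (Finset.sum_nonneg fun _ _ => h0 _), inv_mul_le_iff₀ hL']
  exact (Finset.sum_le_card_nsmul _ _ (L : ℝ) fun _ _ => h1 _).trans (by simp)

/-- The offsets of the windows can be chosen so that finitely many block sums are close to their
averages over all offsets. -/
lemma exists_offsets {ι : Type*} [Fintype ι] (f : ℕ → ι → ℝ) {L T : ℕ} (hL : 0 < L)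
    (h0 : ∀ n τ, 0 ≤ f n τ) (h1 : ∀ n τ, f n τ ≤ L) :
    ∃ r : ℕ → ℕ, (∀ w, r w < L) ∧ ∀ ε > 0, ∀ᶠ J : ℕ in atTop, ∀ τ,
      |∑ b ∈ Finset.range (J * T), f (blockPos L T r b) τ -
        (L : ℝ)⁻¹ * ∑ n ∈ Finset.range (J * (L * (T + 1))), f n τ| ≤ ε * J + J * L := by
  have hL' : (0 : ℝ) < L := by exact_mod_cast hL
  let U : ℕ → ℕ → ι → ℝ := fun w r τ =>
    ∑ j ∈ Finset.range T, f (w * (L * (T + 1)) + (r + j * L)) τ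
  have hU : ∀ w r τ, 0 ≤ U w r τ ∧ U w r τ ≤ T * L := fun w r τ =>
    ⟨Finset.sum_nonneg fun _ _ => h0 _ _,
      (Finset.sum_le_card_nsmul _ _ (L : ℝ) fun _ _ => h1 _ _).trans (by simp)⟩
  have hA : ∀ w τ, 0 ≤ (L : ℝ)⁻¹ * ∑ r ∈ Finset.range L, U w r τ ∧
      (L : ℝ)⁻¹ * ∑ r ∈ Finset.range L, U w r τ ≤ T * L := by
    intro w τ
    refine ⟨mul_nonneg (inv_nonneg.2 hL'.le) (Finset.sum_nonneg fun _ _ => (hU _ _ _).1), ?_⟩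
    rw [inv_mul_le_iff₀ hL']
    exact (Finset.sum_le_card_nsmul _ _ (T * L : ℝ) fun _ _ => (hU _ _ _).2).trans (by simp)
  obtain ⟨r, hr, hlim⟩ := exists_greedy_choice
    (fun w r τ => U w r τ - (L : ℝ)⁻¹ * ∑ r ∈ Finset.range L, U w r τ) (fun r => r < L) (T * L)
    (fun w r τ _ => abs_sub_le_iff.2
      ⟨by linarith [(hU w r τ).2, (hA w τ).1], by linarith [(hU w r τ).1, (hA w τ).2]⟩) (by
      intro w S
      have hz : ∑ r ∈ Finset.range L,
          ∑ τ, S τ * (U w r τ - (L : ℝ)⁻¹ * ∑ r ∈ Finset.range L, U w r τ) ≤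
          ∑ r ∈ Finset.range L, 0 := by
        rw [Finset.sum_comm, Finset.sum_const_zero]
        refine (Finset.sum_eq_zero fun τ _ => ?_).le
        rw [← Finset.mul_sum, Finset.sum_sub_distrib, Finset.sum_const, Finset.card_range,
          nsmul_eq_mul, mul_inv_cancel_left₀ hL'.ne', sub_self, mul_zero]
      obtain ⟨r, hr, h⟩ := Finset.exists_le_of_sum_le ⟨0, Finset.mem_range.2 hL⟩ hz
      exact ⟨r, Finset.mem_range.1 hr, h⟩)
  refine ⟨r, hr, fun ε hε => (hlim ε hε).mono fun J hJ τ => ?_⟩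
  have h2 := sum_offset_average_bounds (fun n => f n τ) T hL (fun n => h0 n τ) (fun n => h1 n τ) J
  have h3 : ∑ b ∈ Finset.range (J * T), f (blockPos L T r b) τ =
      ∑ w ∈ Finset.range J, U w (r w) τ := by
    rw [sum_range_mul_eq]
    exact Finset.sum_congr rfl fun w _ => Finset.sum_congr rfl fun j hj => by
      rw [blockPos_mul_add r w (Finset.mem_range.1 hj)]
  have h4 := hJ τ
  rw [Finset.sum_sub_distrib, ← h3] at h4
  rw [abs_le] at h2 h4 ⊢
  simp only [U] at h4
  constructor <;> linarith [h2.1, h2.2, h4.1, h4.2]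

/-- The indicator of the event that the word of length `m` of `y` at position `i` is not the
initial word of any element of `Y`. -/
def wordMiss (Y : Set (ℕ → ℂ)) (m : ℕ) (y : ℕ → ℂ) (i : ℕ) : ℝ :=
  Set.indicator {n | ¬ ∃ z ∈ Y, ∀ j < m, y (n + j) = z j} 1 i

lemma wordMiss_nonneg (Y : Set (ℕ → ℂ)) (m : ℕ) (y : ℕ → ℂ) (i : ℕ) : 0 ≤ wordMiss Y m y i :=
  Set.indicator_nonneg (fun _ _ => zero_le_one) i

lemma wordMiss_le_one (Y : Set (ℕ → ℂ)) (m : ℕ) (y : ℕ → ℂ) (i : ℕ) : wordMiss Y m y i ≤ 1 :=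
  Set.indicator_le_self' (fun _ _ => zero_le_one) i

lemma wordMiss_eq_zero {Y : Set (ℕ → ℂ)} {m : ℕ} {y : ℕ → ℂ} {i : ℕ} {z : ℕ → ℂ} (hz : z ∈ Y)
    (h : ∀ j < m, y (i + j) = z j) : wordMiss Y m y i = 0 :=
  Set.indicator_of_notMem (not_not.2 ⟨z, hz, h⟩) _

/-- The number of positions before `n` at which `y` misses the words of length `m` of `Y`. -/
def missCount (Y : Set (ℕ → ℂ)) (m n : ℕ) (y : ℕ → ℂ) : ℝ :=
  ∑ i ∈ Finset.range n, wordMiss Y m y i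

/-- At a fixed scale, for positions `r` of the windows and points `z b` filling the blocks, the
concatenation of the blocks. -/
lemma exists_concatenation {K : Set ℂ} (hK : K.Nonempty) {L T : ℕ} (hT : 0 < T) {r : ℕ → ℕ}
    (hr : ∀ w, r w < L) (z : ℕ → ℕ → ℂ) (hz : ∀ b n, z b n ∈ K) :
    ∃ y : ℕ → ℂ, (∀ n, y n ∈ K) ∧ ∀ b, ∀ i < L, y (blockPos L T r b + i) = z b i := by
  obtain ⟨a, ha⟩ := hK
  have hinj := blockPos_injective hT hr
  refine ⟨Function.extend (fun p : ℕ × Fin L => blockPos L T r p.1 + p.2)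
    (fun p => z p.1 p.2) fun _ => a, fun n => ?_, fun b i hi => hinj.extend_apply _ _ (b, ⟨i, hi⟩)⟩
  by_cases h : ∃ p : ℕ × Fin L, blockPos L T r p.1 + p.2 = n
  · obtain ⟨p, rfl⟩ := h
    rw [hinj.extend_apply (fun p : ℕ × Fin L => z p.1 p.2)]
    exact hz _ _
  · rw [Function.extend_apply' _ _ _ h]
    exact ha

/-- The construction at a fixed scale: a point whose words mostly come from `Y` and whose joint
block frequencies with `x` along `nk` are close to those of the joining. -/
lemma exists_approximate_lift {K : Set ℂ} (hKfin : K.Finite) {x : ℕ → ℂ} (hx : ∀ n, x n ∈ K)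
    {nk : ℕ → ℕ} (hnk : Tendsto nk atTop atTop) {ξ : Measure ((ℕ → ℂ) × (ℕ → ℂ))}
    [IsProbabilityMeasure ξ] (hξ : MeasurePreserving shift2 ξ ξ)
    (hsemi : SemiGenerates x nk (ξ.map Prod.fst)) (hξK : ∀ᵐ q ∂ξ, ∀ n, q.1 n ∈ K)
    {Y : Set (ℕ → ℂ)} (hYK : ∀ z ∈ Y, ∀ n, z n ∈ K)
    (hYs : ∀ z ∈ Y, shift z ∈ Y) (hY : ∀ᵐ q ∂ξ, q.2 ∈ Y)
    {ι : Type*} [Fintype ι] (β : ι → Σ m : ℕ, Fin m → ℂ × ℂ) {M : ℕ} (hβ : ∀ τ, (β τ).1 ≤ M)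
    {ε : ℝ} (hε : 0 < ε) :
    ∃ y : ℕ → ℂ, (∀ n, y n ∈ K) ∧ (∀ᶠ n : ℕ in atTop, missCount Y M n y ≤ ε * n) ∧
      ∀ᶠ k in atTop, ∀ τ,
        |hitCount (nk k) x y (β τ) - nk k * ξ.real (pairCylinder (β τ))| ≤ ε * nk k := by
  set δ : ℝ := ε / 8 with hδ
  have hδ0 : 0 < δ := by positivity
  obtain ⟨T, hT⟩ := exists_nat_ge δ⁻¹
  have hT0 : 0 < T := by
    have : (0 : ℝ) < T := (inv_pos.2 hδ0).trans_le hT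
    exact_mod_cast this
  have hTδ : 1 ≤ δ * (T + 1) := by
    rw [inv_le_iff_one_le_mul₀ hδ0] at hT
    linarith
  obtain ⟨L, hL⟩ := exists_nat_ge (max ((M : ℝ) / δ) (M + 1))
  have hLM : (M : ℝ) ≤ δ * L := by
    have := (le_max_left _ _).trans hL
    rwa [div_le_iff₀' hδ0] at this
  have hML : M + 1 ≤ L := by exact_mod_cast (le_max_right _ _).trans hL
  have hL0 : 0 < L := by omega
  have hLr : (0 : ℝ) < L := by exact_mod_cast hL0
  set W : ℕ := L * (T + 1) with hW
  have hW0 : 0 < W := by positivity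
  have hWr : (W : ℝ) = L * (T + 1) := by rw [hW]; push_cast; ring
  obtain ⟨F, hF, hFchoice, hFint⟩ := exists_conditional_hitCount β (L := L) (N := L - M)
    (fun τ => by have := hβ τ; omega) ξ hY
  have hNL : ((L - M : ℕ) : ℝ) = L - M := Nat.cast_sub (by omega)
  have hM0 : (0 : ℝ) ≤ M := Nat.cast_nonneg M
  let f : ℕ → ι → ℝ := fun n τ => F (fun j => x (n + j)) τ
  have hf0 : ∀ n τ, 0 ≤ f n τ := fun n τ => (hF _ τ).1
  have hf1 : ∀ n τ, f n τ ≤ L := fun n τ => (hF _ τ).2.trans (by rw [hNL]; linarith)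
  obtain ⟨r, hr, hravg⟩ := exists_offsets (T := T) f hL0 hf0 hf1
  obtain ⟨z, hzY, hz⟩ := exists_greedy_choice
    (fun b z τ => hitCount (L - M) (fun n => x (blockPos L T r b + n)) z (β τ) -
      f (blockPos L T r b) τ) (· ∈ Y) (L - M : ℕ)
    (fun b z τ _ => abs_sub_le_iff.2
      ⟨by linarith [hitCount_le (L - M) (fun n => x (blockPos L T r b + n)) z (β τ),
          hf0 (blockPos L T r b) τ],
        by linarith [hitCount_nonneg (L - M) (fun n => x (blockPos L T r b + n)) z (β τ),
          (hF (fun j => x (blockPos L T r b + j)) τ).2]⟩)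
    (fun b S => hFchoice (fun n => x (blockPos L T r b + n)) S)
  obtain ⟨y, hyK, hy⟩ := exists_concatenation ⟨x 0, hx 0⟩ hT0 hr z fun b => hYK _ (hzY b)
  have hJ : ∀ n : ℕ, ((n / W : ℕ) : ℝ) * W ≤ n := fun n => by
    exact_mod_cast Nat.div_mul_le_self n W
  have hJL : ∀ n : ℕ, ((n / W : ℕ) : ℝ) * L ≤ δ * n := fun n => by
    have h1 := hJ n
    rw [hWr] at h1
    have h2 := mul_le_mul_of_nonneg_left hTδ (by positivity : (0 : ℝ) ≤ (n / W : ℕ) * L)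
    nlinarith
  have hJTM : ∀ n : ℕ, ((n / W : ℕ) : ℝ) * (T * M) ≤ δ * n := fun n => by
    have h1 := hJ n
    rw [hWr] at h1
    have h2 := mul_le_mul_of_nonneg_left hLM (by positivity : (0 : ℝ) ≤ (n / W : ℕ) * T)
    have h3 : 0 ≤ δ * ((n / W : ℕ) * L) := by positivity
    nlinarith
  have hYit : ∀ i, ∀ z ∈ Y, shift^[i] z ∈ Y := fun i z hz =>
    Set.MapsTo.iterate (s := Y) hYs i hz
  refine ⟨y, hyK, ?_, ?_⟩
  · obtain ⟨N, hN⟩ := exists_nat_ge ((W : ℝ) / δ)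
    filter_upwards [eventually_ge_atTop N] with n hn
    have hWn : (W : ℝ) ≤ δ * n := by
      rw [div_le_iff₀' hδ0] at hN
      exact hN.trans (mul_le_mul_of_nonneg_left (by exact_mod_cast hn) hδ0.le)
    have h1 := (sum_range_div_mul_bounds _ (wordMiss_nonneg Y M y) (wordMiss_le_one Y M y)
      hW0 n).2
    have h2 := (sum_blockPos_bounds _ (wordMiss_nonneg Y M y) (wordMiss_le_one Y M y) (T := T) hr
      (by omega : M ≤ L) (n / W)).2
    have h3 : ∑ b ∈ Finset.range (n / W * T), ∑ i ∈ Finset.range (L - M),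
        wordMiss Y M y (blockPos L T r b + i) = 0 := by
      refine Finset.sum_eq_zero fun b _ => Finset.sum_eq_zero fun i hi => ?_
      have hi := Finset.mem_range.1 hi
      refine wordMiss_eq_zero (hYit i _ (hzY b)) fun j hj => ?_
      rw [shift_iterate_apply, add_assoc, hy b (i + j) (by omega), add_comm]
    rw [h3, ← hW, zero_add, mul_add] at h2
    have := hJL n
    have := hJTM n
    change missCount Y M n y ≤ _ at h1
    have : 0 ≤ δ * n := by positivity
    have : ε * n = 8 * (δ * n) := by rw [hδ]; ring
    linarith
  · have hconv : ∀ᶠ k in atTop, ∀ τ, |(nk k : ℝ)⁻¹ * ∑ n ∈ Finset.range (nk k), f n τ -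
        (L - M) * ξ.real (pairCylinder (β τ))| < δ := by
      refine eventually_all.2 fun τ => ?_
      have hlim := tendsto_average_of_semiGenerates hKfin hx hsemi hL0 fun B => F B τ
      simp only [measureReal_fstCylinder, hFint] at hlim
      rw [sum_setIntegral_fstCylinder hKfin hξK L (integrable_hitCount _ _ _),
        integral_hitCount _ _ hξ, hNL] at hlim
      exact (Metric.tendsto_nhds.1 hlim δ hδ0).mono fun k hk => by rwa [Real.dist_eq] at hk
    have hJtop : Tendsto (fun k => nk k / W) atTop atTop :=
      (Nat.tendsto_div_const_atTop hW0.ne').comp hnk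
    have hTtop : Tendsto (fun k => nk k / W * T) atTop atTop :=
      hJtop.atTop_mul_const' hT0
    obtain ⟨N, hN⟩ := exists_nat_ge ((2 * W : ℝ) / δ)
    filter_upwards [hconv, hJtop.eventually (hravg δ hδ0), hTtop.eventually (hz δ hδ0),
      hnk.eventually_ge_atTop (N + 1)] with k hk1 hk2 hk3 hk4 τ
    replace hk1 := hk1 τ
    replace hk2 := hk2 τ
    replace hk3 := hk3 τ
    set n := nk k
    set ρ := ξ.real (pairCylinder (β τ))
    have hρ0 : 0 ≤ ρ := measureReal_nonneg
    have hρ1 : ρ ≤ 1 := measureReal_le_one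
    have hn0 : (0 : ℝ) < n := by exact_mod_cast (by omega : 0 < n)
    have hWn : 2 * (W : ℝ) ≤ δ * n := by
      rw [div_le_iff₀' hδ0] at hN
      exact hN.trans (mul_le_mul_of_nonneg_left (by exact_mod_cast (by omega)) hδ0.le)
    have hit0 := blockHit_nonneg (β τ) x y
    have hit1 := blockHit_le_one (β τ) x y
    have h1 := sum_range_div_mul_bounds _ hit0 hit1 hW0 n
    have h2 := sum_blockPos_bounds _ hit0 hit1 (T := T) hr (by omega : M ≤ L) (n / W)
    have h3 : ∑ b ∈ Finset.range (n / W * T), ∑ i ∈ Finset.range (L - M),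
        blockHit (β τ) x y (blockPos L T r b + i) = ∑ b ∈ Finset.range (n / W * T),
        hitCount (L - M) (fun n => x (blockPos L T r b + n)) (z b) (β τ) := by
      refine Finset.sum_congr rfl fun b _ => Finset.sum_congr rfl fun i hi =>
        blockHit_congr (fun j _ => by rw [add_assoc]) fun j hj => ?_
      have := Finset.mem_range.1 hi
      have := hβ τ
      rw [add_assoc, hy b (i + j) (by omega)]
    rw [Finset.sum_sub_distrib, ← h3] at hk3
    have h4 := sum_range_div_mul_bounds (fun i => f i τ) (fun i => hf0 i τ) (fun i => hf1 i τ)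
      hW0 n
    rw [← hW] at hk2 h2
    change _ ≤ hitCount n x y (β τ) ∧ hitCount n x y (β τ) ≤ _ at h1
    have hJn : ((n / W : ℕ) : ℝ) ≤ n := by exact_mod_cast Nat.div_le_self n W
    have hJTn : ((n / W * T : ℕ) : ℝ) ≤ n := by
      have : n / W * T ≤ n / W * W := Nat.mul_le_mul_left _ (by rw [hW]; nlinarith)
      exact_mod_cast this.trans (Nat.div_mul_le_self n W)
    have hδn : ε * n = 8 * (δ * n) := by rw [hδ]; ring
    have hI : (L : ℝ)⁻¹ * ∑ i ∈ Finset.range (n / W * W), f i τ ≤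
          (L : ℝ)⁻¹ * ∑ i ∈ Finset.range n, f i τ ∧ (L : ℝ)⁻¹ * ∑ i ∈ Finset.range n, f i τ ≤
          (L : ℝ)⁻¹ * ∑ i ∈ Finset.range (n / W * W), f i τ + W := by
      refine ⟨mul_le_mul_of_nonneg_left h4.1 (inv_nonneg.2 hLr.le), ?_⟩
      refine (mul_le_mul_of_nonneg_left h4.2 (inv_nonneg.2 hLr.le)).trans_eq ?_
      field_simp
    have hIρ : |(L : ℝ)⁻¹ * ∑ i ∈ Finset.range n, f i τ - n * ρ| ≤ 2 * (δ * n) := by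
      have hL1 : (1 : ℝ) ≤ L := by exact_mod_cast hL0
      have e : (L : ℝ)⁻¹ * ∑ i ∈ Finset.range n, f i τ - n * ρ =
          (L : ℝ)⁻¹ * n * ((n : ℝ)⁻¹ * ∑ i ∈ Finset.range n, f i τ - (L - M) * ρ) -
            M / L * n * ρ := by
        field_simp
        ring
      have e1 : |(L : ℝ)⁻¹ * n * ((n : ℝ)⁻¹ * ∑ i ∈ Finset.range n, f i τ - (L - M) * ρ)| ≤
          δ * n := by
        rw [abs_mul, abs_of_nonneg (by positivity), mul_comm δ]
        refine mul_le_mul ?_ hk1.le (abs_nonneg _) hn0.le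
        exact mul_le_of_le_one_left hn0.le (inv_le_one_of_one_le₀ hL1)
      have e2 : |(M : ℝ) / L * n * ρ| ≤ δ * n := by
        rw [abs_of_nonneg (by positivity)]
        refine (mul_le_of_le_one_right (by positivity) hρ1).trans ?_
        exact mul_le_mul_of_nonneg_right ((div_le_iff₀ hLr).2 hLM) hn0.le
      rw [e]
      refine (abs_sub _ _).trans ?_
      linarith
    have hδJ := mul_le_mul_of_nonneg_left hJn hδ0.le
    have hδJT := mul_le_mul_of_nonneg_left hJTn hδ0.le
    have := hJL n
    have := hJTM n
    rw [mul_add] at h2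
    rw [abs_le] at hk2 hk3 hIρ ⊢
    constructor <;> linarith [h1.1, h1.2, h2.1, h2.2, hI.1, hI.2, hk2.1, hk2.2, hk3.1, hk3.2,
      hIρ.1, hIρ.2]

lemma wordMiss_congr {Y : Set (ℕ → ℂ)} {m : ℕ} {y y' : ℕ → ℂ} {i : ℕ}
    (h : ∀ j < m, y (i + j) = y' (i + j)) : wordMiss Y m y i = wordMiss Y m y' i := by
  have : i ∈ {n | ¬ ∃ z ∈ Y, ∀ j < m, y (n + j) = z j} ↔
      i ∈ {n | ¬ ∃ z ∈ Y, ∀ j < m, y' (n + j) = z j} :=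
    not_congr <| exists_congr fun z => and_congr_right fun _ =>
      forall₂_congr fun j hj => by rw [h j hj]
  unfold wordMiss
  by_cases hi : i ∈ {n | ¬ ∃ z ∈ Y, ∀ j < m, y (n + j) = z j}
  · rw [Set.indicator_of_mem hi, Set.indicator_of_mem (this.1 hi)]
  · rw [Set.indicator_of_notMem hi, Set.indicator_of_notMem (fun h' => hi (this.2 h'))]

lemma wordMiss_mono (Y : Set (ℕ → ℂ)) {m m' : ℕ} (hm : m ≤ m') (y : ℕ → ℂ) (i : ℕ) :
    wordMiss Y m y i ≤ wordMiss Y m' y i := by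
  refine Set.indicator_le_indicator_of_subset (fun n hn => ?_) (fun _ => zero_le_one) i
  rintro ⟨z, hz, h⟩
  exact hn ⟨z, hz, fun j hj => h j (hj.trans_le hm)⟩

lemma missCount_mono (Y : Set (ℕ → ℂ)) {m m' : ℕ} (hm : m ≤ m') (n : ℕ) (y : ℕ → ℂ) :
    missCount Y m n y ≤ missCount Y m' n y :=
  Finset.sum_le_sum fun i _ => wordMiss_mono Y hm y i

lemma missCount_le (Y : Set (ℕ → ℂ)) (m n : ℕ) (y : ℕ → ℂ) : missCount Y m n y ≤ n :=
  (Finset.sum_le_card_nsmul _ _ 1 fun _ _ => wordMiss_le_one _ _ _ _).trans (by simp)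

lemma sum_range_le_of_le_on_middle {g h : ℕ → ℝ} (hg : ∀ i, g i ≤ 1) (hh : ∀ i, 0 ≤ h i)
    {a m n : ℕ} (hle : ∀ i, a ≤ i → i + m ≤ n → g i ≤ h i) :
    ∑ i ∈ Finset.range n, g i ≤ ∑ i ∈ Finset.range n, h i + (a + m) := by
  classical
  have h1 : ∑ i ∈ Finset.range n, g i ≤
      ∑ i ∈ Finset.range n, (h i + if i < a ∨ n < i + m then (1 : ℝ) else 0) := by
    refine Finset.sum_le_sum fun i _ => ?_
    split_ifs with hi
    · linarith [hg i, hh i]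
    · push Not at hi
      linarith [hle i hi.1 hi.2]
  have h2 : ((Finset.range n).filter fun i => i < a ∨ n < i + m).card ≤ a + m := by
    have hsub : ((Finset.range n).filter fun i => i < a ∨ n < i + m) ⊆
        Finset.range a ∪ Finset.Ico (n - m) n := by
      intro i hi
      simp only [Finset.mem_filter, Finset.mem_range, Finset.mem_union, Finset.mem_Ico] at hi ⊢
      omega
    refine (Finset.card_le_card hsub).trans ((Finset.card_union_le _ _).trans ?_)
    simp only [Finset.card_range, Nat.card_Ico]
    omega
  rw [Finset.sum_add_distrib, Finset.sum_boole] at h1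
  have h3 : (((Finset.range n).filter fun i => i < a ∨ n < i + m).card : ℝ) ≤ a + m := by
    exact_mod_cast h2
  linarith

/-- Gluing of the points obtained at the successive scales. -/
lemma exists_glued_point {K : Set ℂ} {x : ℕ → ℂ} {nk : ℕ → ℕ} (hnk : StrictMono nk)
    {Y : Set (ℕ → ℂ)} (P : ℕ → (Σ m : ℕ, Fin m → ℂ × ℂ) → Prop)
    (c : (Σ m : ℕ, Fin m → ℂ × ℂ) → ℝ) (v : ℕ → ℕ → ℂ) (hvK : ∀ s n, v s n ∈ K)
    (hmiss : ∀ s : ℕ, ∀ᶠ n : ℕ in atTop, missCount Y s n (v s) ≤ (s + 1 : ℝ)⁻¹ * n)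
    (hhit : ∀ s : ℕ, ∀ᶠ k in atTop, ∀ τ, P s τ →
      |hitCount (nk k) x (v s) τ - nk k * c τ| ≤ (s + 1 : ℝ)⁻¹ * nk k) :
    ∃ y : ℕ → ℂ, (∀ n, y n ∈ K) ∧
      (∀ m : ℕ, ∀ ε > 0, ∀ᶠ n : ℕ in atTop, missCount Y m n y ≤ ε * n) ∧
      ∃ φ : ℕ → ℕ, StrictMono φ ∧ ∀ τ, (∀ᶠ s in atTop, P s τ) →
        Tendsto (fun k => (nk (φ k) : ℝ)⁻¹ * hitCount (nk (φ k)) x y τ) atTop (𝓝 (c τ)) := by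
  have hbound : ∀ s : ℕ, ∃ C : ℕ, ∀ n : ℕ, missCount Y s n (v s) ≤ (s + 1 : ℝ)⁻¹ * n + C := by
    intro s
    obtain ⟨C, hC⟩ := eventually_atTop.1 (hmiss s)
    refine ⟨C, fun n => ?_⟩
    rcases le_total C n with h | h
    · exact (hC n h).trans (by simp)
    · have h1 := missCount_le Y s n (v s)
      have h2 : (n : ℝ) ≤ C := by exact_mod_cast h
      have h3 : 0 ≤ (s + 1 : ℝ)⁻¹ * n := by positivity
      linarith
  choose C hC using hbound
  have hnext : ∀ s a : ℕ, ∃ k, a < k ∧ (s + 1) * (nk a + C s + C (s + 1) + 1) ≤ nk k ∧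
      ∀ τ, P s τ → |hitCount (nk k) x (v s) τ - nk k * c τ| ≤ (s + 1 : ℝ)⁻¹ * nk k := fun s a =>
    ((eventually_gt_atTop a).and
      ((hnk.tendsto_atTop.eventually_ge_atTop _).and (hhit s))).exists
  choose next hlt hlarge hgood using hnext
  let ψ : ℕ → ℕ := fun s => Nat.rec (motive := fun _ => ℕ) 0 (fun s a => next s a) s
  have hψs : ∀ s, ψ (s + 1) = next s (ψ s) := fun _ => rfl
  have hψ : StrictMono ψ := strictMono_nat_of_lt_succ fun s => hlt s (ψ s)
  have hN : StrictMono fun s => nk (ψ s) := hnk.comp hψ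
  have hle : ∀ s, s ≤ nk (ψ s) := fun s => hN.id_le s
  let stage : ℕ → ℕ := fun i => Nat.findGreatest (fun s => nk (ψ s) ≤ i) i
  have hstage : ∀ s i, nk (ψ s) ≤ i → i < nk (ψ (s + 1)) → stage i = s := by
    intro s i h1 h2
    refine le_antisymm ?_ (Nat.le_findGreatest ((hle s).trans h1) h1)
    by_contra! hlt'
    have h3 : nk (ψ (stage i)) ≤ i :=
      Nat.findGreatest_of_ne_zero (P := fun s => nk (ψ s) ≤ i) rfl (by omega)
    exact absurd (hN.monotone hlt') (not_le.2 (h3.trans_lt h2))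
  refine ⟨fun i => v (stage i) i, fun n => hvK _ n, ?_, fun s => ψ (s + 1),
    fun a b h => hψ (Nat.succ_lt_succ h), ?_⟩
  · intro m ε hε
    obtain ⟨t₀, ht₀⟩ := exists_nat_ge ((3 + 2 * m : ℝ) / ε)
    filter_upwards [eventually_ge_atTop (nk (ψ (max m t₀ + 1)))] with n hn
    have hsn : nk (ψ (stage n)) ≤ n :=
      Nat.findGreatest_spec (P := fun s => nk (ψ s) ≤ n)
        ((hle (max m t₀ + 1)).trans hn) hn
    have hge : max m t₀ + 1 ≤ stage n := Nat.le_findGreatest ((hle _).trans hn) hn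
    have hns : n < nk (ψ (stage n + 1)) := by
      by_contra! h
      exact absurd (Nat.le_findGreatest (P := fun s => nk (ψ s) ≤ n) ((hle _).trans h) h)
        (Nat.not_succ_le_self (stage n))
    obtain ⟨t, ht⟩ : ∃ t, stage n = t + 1 := ⟨stage n - 1, by omega⟩
    rw [ht] at hsn hge hns
    have hmt : m ≤ t := (le_max_left m t₀).trans (by omega)
    have ht₀t : t₀ ≤ t := (le_max_right m t₀).trans (by omega)
    have h1 : missCount Y m (nk (ψ (t + 1))) (fun i => v (stage i) i) ≤
        missCount Y m (nk (ψ (t + 1))) (v t) + (nk (ψ t) + m) :=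
      sum_range_le_of_le_on_middle (wordMiss_le_one _ _ _) (wordMiss_nonneg _ _ _)
        fun i hi hi' => (wordMiss_congr fun j hj => by
          rw [hstage t (i + j) (by omega) (by omega)]).le
    have h2 : missCount Y m n (fun i => v (stage i) i) ≤
        missCount Y m (nk (ψ (t + 1))) (fun i => v (stage i) i) +
          missCount Y m n (v (t + 1)) + m := by
      obtain ⟨d, rfl⟩ := Nat.exists_eq_add_of_le hsn
      unfold missCount
      rw [Finset.sum_range_add, Finset.sum_range_add (wordMiss Y m (v (t + 1)))]
      have h3 := sum_range_le_of_le_on_middle (n := d) (a := 0) (m := m)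
        (g := fun i => wordMiss Y m (fun i => v (stage i) i) (nk (ψ (t + 1)) + i))
        (h := fun i => wordMiss Y m (v (t + 1)) (nk (ψ (t + 1)) + i))
        (fun _ => wordMiss_le_one _ _ _ _) (fun _ => wordMiss_nonneg _ _ _ _)
        fun i hi hi' => (wordMiss_congr fun j hj => by
          rw [hstage (t + 1) _ (by omega) (by omega)]).le
      have h4 : 0 ≤ ∑ i ∈ Finset.range (nk (ψ (t + 1))), wordMiss Y m (v (t + 1)) i :=
        Finset.sum_nonneg fun _ _ => wordMiss_nonneg _ _ _ _
      push_cast at h3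
      linarith
    have h3 := (missCount_mono Y hmt (nk (ψ (t + 1))) (v t)).trans (hC t _)
    have h4 := (missCount_mono Y (hmt.trans (Nat.le_succ t)) n (v (t + 1))).trans (hC (t + 1) _)
    have h5 := hlarge t (ψ t)
    rw [← hψs] at h5
    have h5' : ((t : ℝ) + 1) * (nk (ψ t) + C t + C (t + 1) + 1) ≤ n := by
      exact_mod_cast h5.trans hsn
    have ht1 : (0 : ℝ) < t + 1 := by positivity
    set a : ℝ := (t + 1 : ℝ)⁻¹ with ha
    have ha0 : 0 < a := inv_pos.2 ht1
    have h6 : (nk (ψ t) + C t + C (t + 1) + 1 : ℝ) ≤ a * n := (le_inv_mul_iff₀ ht1).2 h5'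
    have h7 : a * nk (ψ (t + 1)) ≤ a * n :=
      mul_le_mul_of_nonneg_left (by exact_mod_cast hsn) ha0.le
    have h8 : ((t + 1 : ℕ) + 1 : ℝ)⁻¹ * n ≤ a * n := by
      refine mul_le_mul_of_nonneg_right (inv_anti₀ ht1 ?_) (Nat.cast_nonneg n)
      push_cast
      linarith
    have h9 : (1 : ℝ) ≤ a * n := le_trans (by
      have : (0 : ℝ) ≤ nk (ψ t) + C t + C (t + 1) := by positivity
      linarith) h6
    have h10 : (3 + 2 * m : ℝ) * (a * n) ≤ ε * n := by
      rw [← mul_assoc]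
      refine mul_le_mul_of_nonneg_right ?_ (Nat.cast_nonneg n)
      rw [ha, ← div_eq_mul_inv, div_le_iff₀ ht1, ← div_le_iff₀' hε]
      have : (t₀ : ℝ) ≤ t := by exact_mod_cast ht₀t
      linarith
    have h11 : (2 * m : ℝ) ≤ 2 * m * (a * n) := le_mul_of_one_le_right (by positivity) h9
    linarith
  · intro τ hτ
    rw [tendsto_iff_norm_sub_tendsto_zero]
    have hz : Tendsto (fun s : ℕ => (2 + τ.1 : ℝ) * (1 / ((s : ℝ) + 1))) atTop (𝓝 0) := by
      simpa using tendsto_one_div_add_atTop_nhds_zero_nat.const_mul (2 + τ.1 : ℝ)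
    refine squeeze_zero' (Eventually.of_forall fun _ => norm_nonneg _) ?_ hz
    filter_upwards [hτ] with s hs
    have hagree : ∀ i, nk (ψ s) ≤ i → i + τ.1 ≤ nk (ψ (s + 1)) →
        blockHit τ x (fun i => v (stage i) i) i = blockHit τ x (v s) i := fun i hi hi' =>
      blockHit_congr (fun _ _ => rfl) fun j hj => by
        rw [hstage s (i + j) (by omega) (by omega)]
    have h1 : hitCount (nk (ψ (s + 1))) x (fun i => v (stage i) i) τ ≤
        hitCount (nk (ψ (s + 1))) x (v s) τ + (nk (ψ s) + τ.1) :=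
      sum_range_le_of_le_on_middle (blockHit_le_one _ _ _) (blockHit_nonneg _ _ _)
        fun i hi hi' => (hagree i hi hi').le
    have h2 : hitCount (nk (ψ (s + 1))) x (v s) τ ≤
        hitCount (nk (ψ (s + 1))) x (fun i => v (stage i) i) τ + (nk (ψ s) + τ.1) :=
      sum_range_le_of_le_on_middle (blockHit_le_one _ _ _) (blockHit_nonneg _ _ _)
        fun i hi hi' => (hagree i hi hi').ge
    have h3 := hgood s (ψ s) τ hs
    have h5 := hlarge s (ψ s)
    rw [← hψs] at h3 h5
    set n := nk (ψ (s + 1))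
    have hs1 : (0 : ℝ) < s + 1 := by positivity
    have h5' : ((s : ℝ) + 1) * (nk (ψ s) + C s + C (s + 1) + 1) ≤ n := by exact_mod_cast h5
    set a : ℝ := (s + 1 : ℝ)⁻¹ with ha
    have h6 : (nk (ψ s) + C s + C (s + 1) + 1 : ℝ) ≤ a * n := (le_inv_mul_iff₀ hs1).2 h5'
    have hpos : (0 : ℝ) ≤ nk (ψ s) + C s + C (s + 1) := by positivity
    have hC0 : (0 : ℝ) ≤ C s + C (s + 1) := by positivity
    have h9 : (1 : ℝ) ≤ a * n := by linarith
    have hn0 : (0 : ℝ) < n := pos_of_mul_pos_right (lt_of_lt_of_le one_pos h9)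
      (inv_pos.2 hs1).le
    have h11 : (τ.1 : ℝ) ≤ τ.1 * (a * n) := le_mul_of_one_le_right (by positivity) h9
    have e : (n : ℝ)⁻¹ * hitCount n x (fun i => v (stage i) i) τ - c τ =
        (n : ℝ)⁻¹ * (hitCount n x (fun i => v (stage i) i) τ - n * c τ) := by
      field_simp
    rw [e, Real.norm_eq_abs, abs_mul, abs_of_pos (inv_pos.2 hn0), inv_mul_le_iff₀ hn0, one_div,
      ← ha]
    rw [abs_le] at h3 ⊢
    constructor <;> linarith [h3.1, h3.2]

/-- The shift map on `K^ℕ`. -/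
def shiftOn (K : Set ℂ) (z : {z : ℕ → ℂ // ∀ n, z n ∈ K}) : {z : ℕ → ℂ // ∀ n, z n ∈ K} :=
  ⟨shift z.1, fun n => z.2 (n + 1)⟩

lemma continuous_shift : Continuous shift :=
  continuous_pi fun n => continuous_apply (n + 1)

lemma continuous_shiftOn (K : Set ℂ) : Continuous (shiftOn K) :=
  (continuous_shift.comp continuous_subtype_val).subtype_mk _

lemma coe_shiftOn_iterate (K : Set ℂ) (i : ℕ) (z : {z : ℕ → ℂ // ∀ n, z n ∈ K}) :
    (((shiftOn K)^[i] z : {z : ℕ → ℂ // ∀ n, z n ∈ K}) : ℕ → ℂ) = shift^[i] z.1 :=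
  (Function.Semiconj.iterate_right (f := Subtype.val) (fun _ => rfl) i) z

/-- The uniform measure on the first `n + 1` points of an orbit. -/
def empiricalMeasure {X : Type*} [MeasurableSpace X] (T : X → X) (x : X) (n : ℕ) :
    ProbabilityMeasure X :=
  ⟨((n + 1 : ℕ) : ENNReal)⁻¹ • ∑ i ∈ Finset.range (n + 1), Measure.dirac (T^[i] x), ⟨by
    simp [ENNReal.inv_mul_cancel]⟩⟩

lemma integral_empiricalMeasure {X E : Type*} [MeasurableSpace X] [TopologicalSpace X]
    [BorelSpace X] [NormedAddCommGroup E] [NormedSpace ℝ E] [CompleteSpace E]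
    [SecondCountableTopology E] (T : X → X) (x : X) (n : ℕ) {g : X → E} (hg : Continuous g) :
    ∫ z, g z ∂(empiricalMeasure T x n : Measure X) =
      ((n + 1 : ℕ) : ℝ)⁻¹ • ∑ i ∈ Finset.range (n + 1), g (T^[i] x) := by
  borelize E
  have hm : StronglyMeasurable g := hg.measurable.stronglyMeasurable
  rw [empiricalMeasure, ProbabilityMeasure.coe_mk, integral_smul_measure,
    integral_finsetSum_measure fun i _ => ?_]
  · simp only [integral_dirac' _ _ hm, ENNReal.toReal_inv, ENNReal.toReal_natCast]
  · exact integrable_dirac' hm (by simp)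

/-- Limits of empirical measures along a continuous map are invariant. -/
lemma map_eq_of_tendsto_empiricalMeasure {X : Type*} [MeasurableSpace X] [TopologicalSpace X]
    [HasOuterApproxClosed X] [BorelSpace X] {T : X → X} (hT : Continuous T) (x : X)
    {F : Filter ℕ} [F.NeBot] (hF : F ≤ atTop) {ρ : ProbabilityMeasure X}
    (hρ : Tendsto (empiricalMeasure T x) F (𝓝 ρ)) : (ρ : Measure X).map T = ρ := by
  have : IsProbabilityMeasure ((ρ : Measure X).map T) :=
    Measure.isProbabilityMeasure_map hT.measurable.aemeasurable
  refine ext_of_forall_integral_eq_of_IsFiniteMeasure fun g => ?_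
  rw [integral_map hT.measurable.aemeasurable g.continuous.measurable.aestronglyMeasurable]
  rw [ProbabilityMeasure.tendsto_iff_forall_integral_tendsto] at hρ
  have h1 := (hρ (g.compContinuous ⟨T, hT⟩)).sub (hρ g)
  have h2 : Tendsto (fun n : ℕ => (1 / ((n : ℝ) + 1)) * (2 * ‖g‖)) F (𝓝 0) := by
    simpa using (tendsto_one_div_add_atTop_nhds_zero_nat.mono_left hF).mul_const (2 * ‖g‖)
  refine sub_eq_zero.1 (tendsto_nhds_unique h1 (squeeze_zero_norm (fun n => ?_) h2))
  rw [integral_empiricalMeasure _ _ _ (BoundedContinuousFunction.continuous _),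
    integral_empiricalMeasure _ _ _ (BoundedContinuousFunction.continuous _), ← smul_sub,
    ← Finset.sum_sub_distrib]
  have h3 : ∑ i ∈ Finset.range (n + 1), ((g.compContinuous ⟨T, hT⟩) (T^[i] x) - g (T^[i] x)) =
      g (T^[n + 1] x) - g x := by
    simpa [Function.iterate_succ_apply'] using Finset.sum_range_sub (fun i => g (T^[i] x)) (n + 1)
  rw [h3, norm_smul, Real.norm_of_nonneg (by positivity)]
  have h4 := (norm_sub_le (g (T^[n + 1] x)) (g x)).trans
    (add_le_add (g.norm_coe_le_norm _) (g.norm_coe_le_norm _))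
  rw [one_div, Nat.cast_succ]
  exact mul_le_mul_of_nonneg_left (by linarith) (by positivity)

lemma mem_of_forall_exists_initial_word {Y : Set (ℕ → ℂ)} (hY : IsClosed Y) {u : ℕ → ℂ}
    (hu : ∀ m : ℕ, ∃ z ∈ Y, ∀ j < m, u j = z j) : u ∈ Y := by
  choose z hz huz using hu
  refine hY.mem_of_tendsto (b := atTop) (f := z) (tendsto_pi_nhds.2 fun j => ?_)
    (Eventually.of_forall hz)
  refine tendsto_const_nhds.congr' ?_
  filter_upwards [eventually_gt_atTop j] with m hm using huz m j hm

lemma isClopen_initial_word {K : Set ℂ} (hK : K.Finite) (Y : Set (ℕ → ℂ)) (m : ℕ) :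
    IsClopen {u : {z : ℕ → ℂ // ∀ n, z n ∈ K} | ¬ ∃ z ∈ Y, ∀ j < m, u.1 j = z j} := by
  have := hK.to_subtype
  let r : {z : ℕ → ℂ // ∀ n, z n ∈ K} → (Fin m → K) := fun u j => ⟨u.1 j, u.2 j⟩
  have hr : Continuous r := continuous_pi fun j =>
    ((continuous_apply (j : ℕ)).comp continuous_subtype_val).subtype_mk _
  convert (isClopen_discrete {w : Fin m → K | ¬ ∃ z ∈ Y, ∀ j : Fin m, (w j : ℂ) = z j}).preimage
    hr using 1
  ext u
  simp [r, Fin.forall_iff]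

/-- A limit of empirical measures of a point almost all of whose words come from `Y` is carried
by `Y`. -/
lemma ae_mem_of_tendsto_empiricalMeasure {K : Set ℂ} (hK : K.Finite) {Y : Set (ℕ → ℂ)}
    (hY : IsClosed Y) {y : {z : ℕ → ℂ // ∀ n, z n ∈ K}}
    (hmiss : ∀ m : ℕ, ∀ ε > 0, ∀ᶠ n : ℕ in atTop, missCount Y m n y.1 ≤ ε * n)
    {F : Filter ℕ} [F.NeBot] (hF : F ≤ atTop)
    {ρ : ProbabilityMeasure {z : ℕ → ℂ // ∀ n, z n ∈ K}}
    (hρ : Tendsto (empiricalMeasure (shiftOn K) y) F (𝓝 ρ)) :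
    ∀ᵐ u ∂(ρ : Measure {z : ℕ → ℂ // ∀ n, z n ∈ K}), u.1 ∈ Y := by
  suffices h : ∀ m : ℕ, ∀ᵐ u ∂(ρ : Measure {z : ℕ → ℂ // ∀ n, z n ∈ K}),
      ∃ z ∈ Y, ∀ j < m, u.1 j = z j by
    filter_upwards [ae_all_iff.2 h] with u hu using mem_of_forall_exists_initial_word hY hu
  intro m
  set E := {u : {z : ℕ → ℂ // ∀ n, z n ∈ K} | ¬ ∃ z ∈ Y, ∀ j < m, u.1 j = z j} with hE
  have hclopen : IsClopen E := isClopen_initial_word hK Y m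
  let g : BoundedContinuousFunction {z : ℕ → ℂ // ∀ n, z n ∈ K} ℝ :=
    BoundedContinuousFunction.indicator E hclopen
  have h1 := (ProbabilityMeasure.tendsto_iff_forall_integral_tendsto.1 hρ) g
  have hg : ∀ i, g ((shiftOn K)^[i] y) = wordMiss Y m y.1 i := by
    intro i
    have : (shiftOn K)^[i] y ∈ E ↔ i ∈ {n | ¬ ∃ z ∈ Y, ∀ j < m, y.1 (n + j) = z j} := by
      simp only [hE, Set.mem_ofPred_eq, coe_shiftOn_iterate, shift_iterate_apply, add_comm]
    simp only [g, BoundedContinuousFunction.indicator_apply, wordMiss]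
    by_cases hi : (shiftOn K)^[i] y ∈ E
    · rw [Set.indicator_of_mem hi, Set.indicator_of_mem (this.1 hi)]; rfl
    · rw [Set.indicator_of_notMem hi, Set.indicator_of_notMem (fun h => hi (this.2 h))]
  have h2 : Tendsto (fun n => ∫ z, g z ∂(empiricalMeasure (shiftOn K) y n :
      Measure {z : ℕ → ℂ // ∀ n, z n ∈ K})) F (𝓝 0) := by
    refine Tendsto.mono_left ?_ hF
    rw [Metric.tendsto_nhds]
    intro ε hε
    filter_upwards [(tendsto_add_atTop_nat 1).eventually (hmiss m (ε / 2) (by positivity))]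
      with n hn
    rw [integral_empiricalMeasure _ _ _ g.continuous, Real.dist_0_eq_abs, smul_eq_mul,
      Finset.sum_congr rfl fun i _ => hg i, abs_of_nonneg
        (mul_nonneg (by positivity) (Finset.sum_nonneg fun _ _ => wordMiss_nonneg _ _ _ _)),
      inv_mul_lt_iff₀ (by positivity)]
    refine hn.trans_lt ?_
    have : (0 : ℝ) < (n + 1 : ℕ) := by positivity
    nlinarith
  have h3 := tendsto_nhds_unique h1 h2
  have h4 : ∫ z, g z ∂(ρ : Measure {z : ℕ → ℂ // ∀ n, z n ∈ K}) =
      (ρ : Measure {z : ℕ → ℂ // ∀ n, z n ∈ K}).real E := by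
    rw [← integral_indicator_one hclopen.isOpen.measurableSet]
    rfl
  rw [h4, measureReal_eq_zero_iff] at h3
  exact h3

/-- Genericity of a point almost all of whose words come from the support of a uniquely ergodic
measure. -/
lemma isGeneric_of_missCount {K : Set ℂ} (hK : K.Finite) {ν : Measure (ℕ → ℂ)}
    (hν : MeasurePreserving shift ν ν) {Y : Set (ℕ → ℂ)} (hY : IsClosed Y)
    (huniq : ∀ ρ : Measure (ℕ → ℂ), InvariantProb ρ → ρ Y = 1 → ρ = ν)
    {y : ℕ → ℂ} (hyK : ∀ n, y n ∈ K)
    (hmiss : ∀ m : ℕ, ∀ ε > 0, ∀ᶠ n : ℕ in atTop, missCount Y m n y ≤ ε * n) :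
    IsGeneric y ν := by
  intro f
  have : CompactSpace {z : ℕ → ℂ // ∀ n, z n ∈ K} := by
    have h := isCompact_univ_pi fun _ : ℕ => hK.isCompact
    rw [show Set.pi Set.univ (fun _ : ℕ => K) = {z : ℕ → ℂ | ∀ n, z n ∈ K} by ext; simp] at h
    exact isCompact_iff_compactSpace.1 h
  have : TopologicalSpace.PseudoMetrizableSpace {z : ℕ → ℂ // ∀ n, z n ∈ K} :=
    IsInducing.subtypeVal.pseudoMetrizableSpace
  set y₀ : {z : ℕ → ℂ // ∀ n, z n ∈ K} := ⟨y, hyK⟩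
  have key : ∀ g : C((ℕ → ℂ), ℂ), Tendsto (fun n : ℕ => ∫ z, g z.1 ∂(empiricalMeasure (shiftOn K)
      y₀ n : Measure {z : ℕ → ℂ // ∀ n, z n ∈ K})) atTop (𝓝 (∫ z, g z ∂ν)) := by
    intro g
    rw [tendsto_iff_ultrafilter]
    intro F hF
    obtain ⟨ρ, -, hρ⟩ := isCompact_univ.ultrafilter_le_nhds
      (F.map (empiricalMeasure (shiftOn K) y₀)) (by simp)
    have hρ' : Tendsto (empiricalMeasure (shiftOn K) y₀) F (𝓝 ρ) := hρ
    have hmeas : Measurable (Subtype.val : {z : ℕ → ℂ // ∀ n, z n ∈ K} → ℕ → ℂ) :=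
      measurable_subtype_coe
    have hν : (ρ : Measure {z : ℕ → ℂ // ∀ n, z n ∈ K}).map Subtype.val = ν := by
      have hprob := Measure.isProbabilityMeasure_map
        (μ := (ρ : Measure {z : ℕ → ℂ // ∀ n, z n ∈ K})) hmeas.aemeasurable
      refine huniq _ ⟨hprob, measurable_shift, ?_⟩ ?_
      · have hinv := map_eq_of_tendsto_empiricalMeasure (continuous_shiftOn K) y₀ hF hρ'
        conv_rhs => rw [← hinv]
        rw [Measure.map_map measurable_shift hmeas,
          Measure.map_map hmeas (continuous_shiftOn K).measurable]
        rfl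
      · rw [← mem_ae_iff_prob_eq_one hY.measurableSet,
          mem_ae_map_iff hmeas.aemeasurable hY.measurableSet]
        exact ae_mem_of_tendsto_empiricalMeasure hK hY hmiss hF hρ'
    rw [← hν, integral_map hmeas.aemeasurable g.continuous.measurable.aestronglyMeasurable]
    exact ProbabilityMeasure.tendsto_iff_forall_integral_rclike_tendsto ℂ |>.1 hρ'
      (BoundedContinuousFunction.mkOfCompact ⟨fun z => g z.1, by fun_prop⟩)
  rw [← tendsto_add_atTop_iff_nat 1]
  have h := key (f.comp ⟨shift, continuous_shift⟩)
  have h_integral : ∫ z, f z ∂ν = ∫ z, f (shift z) ∂ν := by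
    conv_lhs => rw [← hν.map_eq]
    exact integral_map measurable_shift.aemeasurable
      f.continuous.measurable.aestronglyMeasurable
  rw [h_integral]
  refine h.congr fun n => ?_
  rw [integral_empiricalMeasure _ _ _ (by fun_prop), Complex.real_smul]
  simp [coe_shiftOn_iterate, Function.iterate_succ_apply', y₀]

lemma measSupport_eq_support (ν : Measure (ℕ → ℂ)) : measSupport ν = ν.support := by
  rw [Measure.support_eq_forall_isOpen]
  exact Set.ext fun z => forall_congr' fun U => forall_comm

lemma isClosed_measSupport (ν : Measure (ℕ → ℂ)) : IsClosed (measSupport ν) :=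
  measSupport_eq_support ν ▸ Measure.isClosed_support

lemma ae_mem_measSupport (ν : Measure (ℕ → ℂ)) : ∀ᵐ z ∂ν, z ∈ measSupport ν :=
  measSupport_eq_support ν ▸ Measure.support_mem_ae

lemma shift_mem_measSupport {ν : Measure (ℕ → ℂ)} (hν : MeasurePreserving shift ν ν)
    {z : ℕ → ℂ} (hz : z ∈ measSupport ν) : shift z ∈ measSupport ν := fun U hU hzU => by
  rw [← hν.measure_preimage hU.measurableSet.nullMeasurableSet]
  exact hz _ (hU.preimage continuous_shift) hzU

lemma isClosed_sequences {K : Set ℂ} (hK : K.Finite) : IsClosed {z : ℕ → ℂ | ∀ n, z n ∈ K} := by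
  simp only [Set.ofPred_forall]
  exact isClosed_iInter fun n => hK.isClosed.preimage (continuous_apply n)

lemma SupportedOn.ae_mem {μ : Measure (ℕ → ℂ)} [IsProbabilityMeasure μ] {K : Set ℂ}
    (hK : K.Finite) (h : SupportedOn μ K) : ∀ᵐ z ∂μ, ∀ n, z n ∈ K :=
  (mem_ae_iff_prob_eq_one (isClosed_sequences hK).measurableSet).2 h

lemma SupportedOn.measSupport_subset {μ : Measure (ℕ → ℂ)} [IsProbabilityMeasure μ] {K : Set ℂ}
    (hK : K.Finite) (h : SupportedOn μ K) : ∀ z ∈ measSupport μ, ∀ n, z n ∈ K := by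
  rw [measSupport_eq_support]
  exact Measure.support_subset_of_isClosed (isClosed_sequences hK) (h.ae_mem hK)

lemma hitCount_eq_card (n : ℕ) (u z : ℕ → ℂ) (m : ℕ) (B : Fin m → ℂ × ℂ) :
    hitCount n u z ⟨m, B⟩ = ((Finset.range n).filter
      fun i => ∀ j : Fin m, (u (i + j.1), z (i + j.1)) = B j).card := by
  simp only [hitCount, blockHit, Finset.card_filter, Nat.cast_sum]
  refine Finset.sum_congr rfl fun i _ => ?_
  by_cases h : ∀ j : Fin m, (u (i + j.1), z (i + j.1)) = B j <;> simp [h]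

/-- If `x` semi-generates `μ` along `(n_k)` and `ξ` is a joining of `μ`
with a strictly ergodic measure `ν`, then there is a point `y`, generic for `ν`, such that
`(x,y)` semi-generates `ξ` along a sub-subsequence of `(n_k)`. -/
theorem stmt11 (K : Set ℂ) (hKfin : K.Finite) (hKball : K ⊆ Metric.closedBall 0 1)
    (x : ℕ → ℂ) (hx : ∀ n, x n ∈ K)
    (nk : ℕ → ℕ) (hnk : StrictMono nk)
    (μ : Measure (ℕ → ℂ)) (hμ : InvariantProb μ) (hμK : SupportedOn μ K)
    (hsemi : SemiGenerates x nk μ)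
    (ν : Measure (ℕ → ℂ)) (hνK : SupportedOn ν K) (hν : StrictlyErgodicMeasure ν)
    (ξ : Measure ((ℕ → ℂ) × (ℕ → ℂ))) (hξ : IsJoining ξ μ ν) :
    ∃ y : ℕ → ℂ, (∀ n, y n ∈ K) ∧ IsGeneric y ν ∧
      ∃ φ : ℕ → ℕ, StrictMono φ ∧ SemiGenerates2 (x, y) (nk ∘ φ) ξ := by
  obtain ⟨⟨hνprob, hνinv⟩, -, huniq⟩ := hν
  obtain ⟨hμprob, -⟩ := hμ
  obtain ⟨hξprob, hξinv, hfst, hsnd⟩ := hξ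
  have hKtype := hKfin.to_subtype
  have hνY : ν (measSupport ν) = 1 :=
    (mem_ae_iff_prob_eq_one (isClosed_measSupport ν).measurableSet).1 (ae_mem_measSupport ν)
  have hξK : ∀ᵐ q ∂ξ, ∀ n, q.1 n ∈ K :=
    ae_of_ae_map measurable_fst.aemeasurable (hfst ▸ hμK.ae_mem hKfin)
  have hξY : ∀ᵐ q ∂ξ, q.2 ∈ measSupport ν :=
    ae_of_ae_map measurable_snd.aemeasurable (hsnd ▸ ae_mem_measSupport ν)
  have hYK := hνK.measSupport_subset hKfin
  let word : (Σ m : ℕ, Fin m → K × K) → Σ m : ℕ, Fin m → ℂ × ℂ := fun B =>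
    ⟨B.1, fun j => ((B.2 j).1, (B.2 j).2)⟩
  have happrox : ∀ s : ℕ, ∃ v : ℕ → ℂ, (∀ n, v n ∈ K) ∧
      (∀ᶠ n : ℕ in atTop, missCount (measSupport ν) s n v ≤ (s + 1 : ℝ)⁻¹ * n) ∧
      ∀ᶠ k in atTop, ∀ τ, (∃ B, word B = τ ∧ B.1 ≤ s) →
        |hitCount (nk k) x v τ - nk k * ξ.real (pairCylinder τ)| ≤ (s + 1 : ℝ)⁻¹ * nk k := by
    intro s
    have := Fintype.ofFinite K
    obtain ⟨v, hvK, hmiss, hhit⟩ := exists_approximate_lift hKfin hx hnk.tendsto_atTop hξinv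
      (hfst.symm ▸ hsemi) hξK hYK (fun _ => shift_mem_measSupport hνinv) hξY
      (ι := Σ m : Fin (s + 1), Fin m → K × K) (fun B => word ⟨B.1, B.2⟩) (M := s)
      (fun B => Nat.le_of_lt_succ B.1.2) (ε := (s + 1 : ℝ)⁻¹) (by positivity)
    refine ⟨v, hvK, hmiss, hhit.mono fun k hk => ?_⟩
    rintro _ ⟨B, rfl, hB⟩
    exact hk ⟨⟨B.1, Nat.lt_succ_of_le hB⟩, B.2⟩
  choose v hvK hmiss hhit using happrox
  obtain ⟨y, hyK, hymiss, φ, hφ, hyhit⟩ := exists_glued_point hnk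
    (fun s τ => ∃ B, word B = τ ∧ B.1 ≤ s) (fun τ => ξ.real (pairCylinder τ)) v hvK hmiss hhit
  refine ⟨y, hyK, isGeneric_of_missCount hKfin hνinv (isClosed_measSupport ν)
    (fun ρ h h' => huniq.unique ⟨h, h'⟩ ⟨⟨hνprob, hνinv⟩, hνY⟩) hyK hymiss, φ, hφ,
    fun m _ B => ?_⟩
  simp only [← hitCount_eq_card, Function.comp_apply]
  by_cases hB : ∀ j, (B j).1 ∈ K ∧ (B j).2 ∈ K
  · exact hyhit ⟨m, B⟩ ((eventually_ge_atTop m).mono fun s hs =>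
      ⟨⟨m, fun j => (⟨_, (hB j).1⟩, ⟨_, (hB j).2⟩)⟩, rfl, hs⟩)
  · push Not at hB
    obtain ⟨j, hj⟩ := hB
    have h0 : ∀ n, hitCount n x y ⟨m, B⟩ = 0 := by
      intro n
      rw [hitCount_eq_card, Finset.filter_false_of_mem, Finset.card_empty, Nat.cast_zero]
      intro i _ h
      refine hj ?_ ?_
      · rw [← h j]; exact hx _
      · rw [← h j]; exact hyK _
    have hξ0 : ξ {q | ∀ j : Fin m, (q.1 j.1, q.2 j.1) = B j} = 0 := by
      rw [measure_eq_zero_iff_ae_notMem]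
      filter_upwards [hξK, hξY] with q h1 h2 h
      refine hj ?_ ?_
      · rw [← h j]; exact h1 _
      · rw [← h j]; exact hYK _ h2 _
    simp [h0, hξ0]
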